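/- Let μ ≥ 0 and η > η̄. For every (β̃,γ̃) ∈ ℝ^p × ℝ^q the problem min_{(β,γ) ∈ ℝ^p×ℝ^q} L_{η,μ}((β,γ),(β̃,γ̃)) has a unique optimal solution; consequently the solution mapping S_{η,μ} : ℝ^p×ℝ^q → ℝ^p×ℝ_+^q is well defined and single-valued, the optimal value function u_{η,μ} is finite everywhere, and both u_{η,μ} and S_{η,μ} are continuous on ℝ^p × ℝ^q. -/

import Mathlib

open Matrix Real Filter Topology Bornology
open scoped Pointwise

noncomputable section

abbrev Vec (k : ℕ) : Type := Fin k → ℝ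

/-- Euclidean norm of a vector. -/
def eNorm {ι : Type*} [Fintype ι] (x : ι → ℝ) : ℝ := Real.sqrt (∑ j, (x j) ^ 2)

/-- Squared Euclidean norm of a pair of vectors. -/
def sqnorm2 {p q : ℕ} (w : Vec p × Vec q) : ℝ :=
  (∑ j, (w.1 j) ^ 2) + ∑ j, (w.2 j) ^ 2

/-- ℓ²→ℓ² operator norm of a matrix (its largest singular value). -/
def opNorm {ι κ : Type*} [Fintype ι] [Fintype κ] (M : Matrix ι κ ℝ) : ℝ :=
  sInf {c : ℝ | 0 ≤ c ∧ ∀ x : κ → ℝ, eNorm (M.mulVec x) ≤ c * eNorm x}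

/-- Smallest eigenvalue of a symmetric matrix, via Rayleigh quotients. -/
def minEig {ι : Type*} [Fintype ι] (M : Matrix ι ι ℝ) : ℝ :=
  sInf {r : ℝ | ∃ x : ι → ℝ, eNorm x = 1 ∧ r = x ⬝ᵥ M.mulVec x}

/-- Largest eigenvalue of a symmetric matrix, via Rayleigh quotients. -/
def maxEig {ι : Type*} [Fintype ι] (M : Matrix ι ι ℝ) : ℝ :=
  sSup {r : ℝ | ∃ x : ι → ℝ, eNorm x = 1 ∧ r = x ⬝ᵥ M.mulVec x}

/-- The log-barrier (perspective of the negative log). -/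
def phiBar (μ : ℝ) {q : ℕ} (γ : Vec q) : EReal :=
  if μ = 0 then (if ∀ j, 0 ≤ γ j then (0 : EReal) else ⊤)
  else if 0 < μ then
    (if ∀ j, 0 < γ j then (((-μ) * ∑ j, Real.log (γ j / μ) : ℝ) : EReal) else ⊤)
  else ⊤

/-- The coupling function κ_η. -/
def kappaFun (η : ℝ) {p q : ℕ} (w : Vec p × Vec q) : ℝ := η / 2 * sqnorm2 w

/-- 1-coercivity: liminf of F(w)/‖w‖ as ‖w‖ → ∞ is positive. -/
def OneCoercive {p q : ℕ} (R : Vec p × Vec q → EReal) : Prop :=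
  ∃ c : ℝ, 0 < c ∧ ∃ r : ℝ, ∀ w : Vec p × Vec q,
    r ≤ Real.sqrt (sqnorm2 w) → ((c * Real.sqrt (sqnorm2 w) : ℝ) : EReal) ≤ R w

/-- Data of a linear mixed-effects model. -/
structure LMEData (m p q : ℕ) where
  n : Fin m → ℕ
  X : ∀ i, Matrix (Fin (n i)) (Fin p) ℝ
  Z : ∀ i, Matrix (Fin (n i)) (Fin q) ℝ
  y : ∀ i, Fin (n i) → ℝ
  lam : ∀ i, Matrix (Fin (n i)) (Fin (n i)) ℝ

namespace LMEData

variable {m p q : ℕ}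

/-- Ω_i(Γ) = Z_i Γ Z_iᵀ + Λ_i. -/
def Omega (D : LMEData m p q) (Γ : Matrix (Fin q) (Fin q) ℝ) (i : Fin m) :
    Matrix (Fin (D.n i)) (Fin (D.n i)) ℝ :=
  D.Z i * Γ * (D.Z i)ᵀ + D.lam i

/-- The marginal negative log-likelihood L_ML(β, Γ). -/
def LML (D : LMEData m p q) (β : Vec p) (Γ : Matrix (Fin q) (Fin q) ℝ) : ℝ :=
  ∑ i, ((1 : ℝ) / 2 * ((D.y i - D.X i *ᵥ β) ⬝ᵥ ((D.Omega Γ i)⁻¹ *ᵥ (D.y i - D.X i *ᵥ β)))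
    + (1 : ℝ) / 2 * Real.log (D.Omega Γ i).det)

/-- L(β, γ) = L_ML(β, Diag γ). -/
def L (D : LMEData m p q) (β : Vec p) (γ : Vec q) : ℝ := D.LML β (Matrix.diagonal γ)

/-- ν = max_i (1/2) μ_min(Λ_i)^{-2} σ_max(Z_i)^4. -/
def nu (D : LMEData m p q) : ℝ :=
  ⨆ i : Fin m, (1 : ℝ) / 2 * ((minEig (D.lam i)) ^ 2)⁻¹ * (opNorm (D.Z i)) ^ 4

/-- η̄ = ν m. -/
def etabar (D : LMEData m p q) : ℝ := D.nu * m

/-- L_{η,μ}((β,γ),(β̃,γ̃)) = L(β,γ) + φ_μ(γ) + κ_η(β−β̃,γ−γ̃). -/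
def Lrelax (D : LMEData m p q) (η μ : ℝ) (x w : Vec p × Vec q) : EReal :=
  ((D.L x.1 x.2 + kappaFun η (x - w) : ℝ) : EReal) + phiBar μ x.2

/-- The optimal value function u_{η,μ} (with extended-real values). -/
def uval (D : LMEData m p q) (η μ : ℝ) (w : Vec p × Vec q) : EReal :=
  ⨅ x : Vec p × Vec q, D.Lrelax η μ x w

/-- The (real-valued) optimal value function u_{η,μ}. -/
def ufun (D : LMEData m p q) (η μ : ℝ) (w : Vec p × Vec q) : ℝ := (D.uval η μ w).toReal

/-- Partial gradient ∇_β L. -/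
def gradB (D : LMEData m p q) (β : Vec p) (γ : Vec q) : Vec p :=
  fun j => fderiv ℝ (fun b => D.L b γ) β (Pi.single j 1)

/-- Partial gradient ∇_γ L. -/
def gradG (D : LMEData m p q) (β : Vec p) (γ : Vec q) : Vec q :=
  fun j => fderiv ℝ (fun g => D.L β g) γ (Pi.single j 1)

/-- The map G_{η,μ}. -/
def Gmap (D : LMEData m p q) (η μ : ℝ) (x : Vec p × Vec q × Vec q) (w : Vec p × Vec q) :
    Vec p × Vec q × Vec q :=
  (D.gradB x.1 x.2.1 + η • (x.1 - w.1),
   D.gradG x.1 x.2.1 + η • (x.2.1 - w.2) - x.2.2,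
   fun j => x.2.2 j * x.2.1 j - μ)

/-- Second-derivative block ∇²_{ββ} L. -/
def hessBB (D : LMEData m p q) (β : Vec p) (γ : Vec q) : Matrix (Fin p) (Fin p) ℝ :=
  Matrix.of fun j k => fderiv ℝ (fun b => D.gradB b γ j) β (Pi.single k 1)

/-- Second-derivative block ∇²_{γγ} L. -/
def hessGG (D : LMEData m p q) (β : Vec p) (γ : Vec q) : Matrix (Fin q) (Fin q) ℝ :=
  Matrix.of fun j k => fderiv ℝ (fun g => D.gradG β g j) γ (Pi.single k 1)

/-- Second-derivative block ∇²_{γβ} L (the p×q cross block). -/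
def hessGB (D : LMEData m p q) (β : Vec p) (γ : Vec q) : Matrix (Fin p) (Fin q) ℝ :=
  Matrix.of fun j k => fderiv ℝ (fun g => D.gradB β g j) γ (Pi.single k 1)

/-- Second-derivative block ∇²_{βγ} L (the q×p cross block). -/
def hessBG (D : LMEData m p q) (β : Vec p) (γ : Vec q) : Matrix (Fin q) (Fin p) ℝ :=
  Matrix.of fun j k => fderiv ℝ (fun b => D.gradG b γ j) β (Pi.single k 1)

end LMEData

/-- f(r, M) = (1/2)(rᵀM⁻¹r + ln det M). -/
def fRM {n : ℕ} (r : Vec n) (M : Matrix (Fin n) (Fin n) ℝ) : ℝ :=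
  (1 : ℝ) / 2 * (r ⬝ᵥ (M⁻¹ *ᵥ r) + Real.log M.det)


section MatrixPart
open scoped MatrixOrder Matrix.Norms.L2Operator

lemma psd_fact {n : Type*} [Fintype n] [DecidableEq n] {A : Matrix n n ℝ} (hA : A.PosSemidef) :
    ∃ R : Matrix n n ℝ, A = Rᴴ * R := by
  obtain ⟨y, hy⟩ := CStarAlgebra.nonneg_iff_eq_star_mul_self.mp hA.nonneg
  exact ⟨y, hy⟩
end MatrixPart

lemma trace_mul_nonneg' {n : Type*} [Fintype n] [DecidableEq n] {A B : Matrix n n ℝ}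
    (hA : A.PosSemidef) (hB : B.PosSemidef) : 0 ≤ (A * B).trace := by
  obtain ⟨R, rfl⟩ := psd_fact hB
  rw [← Matrix.mul_assoc, Matrix.trace_mul_comm, ← Matrix.mul_assoc]
  exact (hA.mul_mul_conjTranspose_same R).trace_nonneg

lemma logdet_le_trace {n : Type*} [Fintype n] [DecidableEq n] {A : Matrix n n ℝ}
    (hA : A.PosDef) : Real.log A.det ≤ A.trace - Fintype.card n := by
  have h1 : A.det = ∏ i, hA.1.eigenvalues i := by simpa using hA.1.det_eq_prod_eigenvalues
  have h2 : A.trace = ∑ i, hA.1.eigenvalues i := by simpa using hA.1.trace_eq_sum_eigenvalues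
  rw [h1, h2, Real.log_prod (fun i _ => (hA.eigenvalues_pos i).ne')]
  have : ∑ i, Real.log (hA.1.eigenvalues i) ≤ ∑ i, (hA.1.eigenvalues i - 1) :=
    Finset.sum_le_sum fun i _ => Real.log_le_sub_one_of_pos (hA.eigenvalues_pos i)
  simpa [Finset.sum_sub_distrib] using this

lemma logdet_le {n : Type*} [Fintype n] [DecidableEq n] {X Y : Matrix n n ℝ}
    (hX : X.PosDef) (hY : Y.PosDef) :
    Real.log X.det ≤ Real.log Y.det + (Y⁻¹ * X).trace - Fintype.card n := by
  obtain ⟨R, hR⟩ := psd_fact hY.inv.posSemidef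
  have hdY : Y.det ≠ 0 := hY.det_pos.ne'
  have hdR : R.det * R.det * Y.det = 1 := by
    have h := congrArg Matrix.det hR
    rw [Matrix.det_mul, Matrix.det_conjTranspose, Matrix.det_nonsing_inv] at h
    simp only [Ring.inverse_eq_inv', star_trivial] at h
    rw [← h]; field_simp
  have hR0 : R.det ≠ 0 := by rintro h; simp [h] at hdR
  have hu : IsUnit R := (Matrix.isUnit_iff_isUnit_det R).2 (isUnit_iff_ne_zero.2 hR0)
  have hP : (R * X * Rᴴ).PosDef :=
    hX.mul_mul_conjTranspose_same (Matrix.vecMul_injective_iff_isUnit.2 hu)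
  have h := logdet_le_trace hP
  have ht : (R * X * Rᴴ).trace = (Y⁻¹ * X).trace := by
    rw [hR, Matrix.trace_mul_comm, ← Matrix.mul_assoc]
  have hd : (R * X * Rᴴ).det * Y.det = X.det := by
    rw [Matrix.det_mul, Matrix.det_mul, Matrix.det_conjTranspose]
    simp only [star_trivial]
    linear_combination X.det * hdR
  have := Real.log_mul hP.det_pos.ne' hdY
  rw [hd] at this
  rw [ht] at h
  linarith

lemma logdet_add_le {n : Type*} [Fintype n] [DecidableEq n] {B N : Matrix n n ℝ}
    (hB : B.PosDef) (hN : N.PosSemidef) :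
    Real.log (B + N).det ≤ Real.log B.det + (B⁻¹ * N).trace := by
  have h := logdet_le (hB.add_posSemidef hN) hB
  have hu : IsUnit B.det := isUnit_iff_ne_zero.2 hB.det_pos.ne'
  rw [Matrix.mul_add, Matrix.nonsing_inv_mul _ hu, Matrix.trace_add, Matrix.trace_one] at h
  linarith

lemma logdet_mono {n : Type*} [Fintype n] [DecidableEq n] {B N : Matrix n n ℝ}
    (hB : B.PosDef) (hN : N.PosSemidef) :
    Real.log B.det ≤ Real.log (B + N).det := by
  have hY := hB.add_posSemidef hN
  have h := logdet_le hB hY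
  have hu : IsUnit (B + N).det := isUnit_iff_ne_zero.2 hY.det_pos.ne'
  have e : (B + N)⁻¹ * B = 1 - (B + N)⁻¹ * N := by
    rw [eq_sub_iff_add_eq, ← Matrix.mul_add, Matrix.nonsing_inv_mul _ hu]
  rw [e, Matrix.trace_sub, Matrix.trace_one] at h
  have := trace_mul_nonneg' hY.inv.posSemidef hN
  linarith

lemma logdet_mid {n : Type*} [Fintype n] [DecidableEq n] {M E A B : Matrix n n ℝ}
    (hA : A.PosDef) (hB : B.PosDef) (hM : M.PosDef) (hE : E.IsHermitian)
    (eA : A = M + E) (eB : B = M - E) :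
    2 * Real.log M.det - Real.log A.det - Real.log B.det ≤ (B⁻¹ * (E * A⁻¹ * E)).trace := by
  have hN : (E * A⁻¹ * E).PosSemidef := by
    have := hA.inv.posSemidef.mul_mul_conjTranspose_same E
    rwa [hE.eq] at this
  have h := logdet_add_le hB hN
  have hu : IsUnit A.det := isUnit_iff_ne_zero.2 hA.det_pos.ne'
  have e1 : M = A - E := by rw [eA]; abel
  have e2 : B = A - E - E := by rw [eA, eB]; abel
  have e : B + E * A⁻¹ * E = M * A⁻¹ * M := by
    rw [e1, e2, Matrix.sub_mul, Matrix.mul_nonsing_inv _ hu, Matrix.sub_mul, Matrix.mul_sub, Matrix.mul_sub,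
      Matrix.mul_assoc E A⁻¹ A, Matrix.nonsing_inv_mul _ hu, Matrix.mul_one]
    simp only [Matrix.one_mul]
    abel
  have hd : (B + E * A⁻¹ * E).det = M.det * M.det / A.det := by
    rw [e, Matrix.det_mul, Matrix.det_mul, Matrix.det_nonsing_inv]
    simp only [Ring.inverse_eq_inv']
    field_simp
  have hm := hM.det_pos.ne'
  rw [hd, Real.log_div (mul_ne_zero hm hm) hA.det_pos.ne', Real.log_mul hm hm] at h
  linarith

/-- the Hadamard-type trace bound -/
lemma trace_bound {q : ℕ} {P Q : Matrix (Fin q) (Fin q) ℝ} {s : ℝ} (hs : 0 ≤ s)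
    (hQ : Q.PosSemidef) (hP1 : (s • (1 : Matrix (Fin q) (Fin q) ℝ) - P).PosSemidef)
    (hQ1 : (s • (1 : Matrix (Fin q) (Fin q) ℝ) - Q).PosSemidef) (d : Fin q → ℝ) :
    (P * (diagonal d * Q * diagonal d)).trace ≤ s ^ 2 * ∑ j, d j ^ 2 := by
  have hD : (diagonal d)ᴴ = diagonal d := by simp
  have hN : (diagonal d * Q * diagonal d).PosSemidef := by
    have := hQ.mul_mul_conjTranspose_same (diagonal d)
    rwa [hD] at this
  have h1 := trace_mul_nonneg' hP1 hN
  rw [Matrix.sub_mul, Matrix.trace_sub, Matrix.smul_mul, Matrix.one_mul, Matrix.trace_smul] at h1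
  have h2 : (diagonal d * Q * diagonal d).trace ≤ s * ∑ j, d j ^ 2 := by
    rw [Finset.mul_sum]
    simp only [Matrix.trace, Matrix.diag]
    refine Finset.sum_le_sum fun j _ => ?_
    have := hQ1.diag_nonneg (i := j)
    simp at this
    rw [Matrix.mul_diagonal, Matrix.diagonal_mul]
    nlinarith [sq_nonneg (d j)]
  simp only [smul_eq_mul] at h1
  nlinarith [mul_le_mul_of_nonneg_left h2 hs]

/-- matrix-fractional inequality -/
lemma frac_ge {n : ℕ} {A : Matrix (Fin n) (Fin n) ℝ} (hA : A.PosDef) (r v : Fin n → ℝ) :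
    2 * (v ⬝ᵥ r) - v ⬝ᵥ A *ᵥ v ≤ r ⬝ᵥ A⁻¹ *ᵥ r := by
  have hu : IsUnit A.det := isUnit_iff_ne_zero.2 hA.det_pos.ne'
  have h := hA.posSemidef.dotProduct_mulVec_nonneg (v - A⁻¹ *ᵥ r)
  have hT : Aᵀ = A := by simpa using hA.1.eq
  have e1 : A *ᵥ (A⁻¹ *ᵥ r) = r := by
    rw [Matrix.mulVec_mulVec, Matrix.mul_nonsing_inv _ hu, Matrix.one_mulVec]
  have e2 : (A⁻¹ *ᵥ r) ⬝ᵥ A *ᵥ v = v ⬝ᵥ r := by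
    rw [Matrix.dotProduct_mulVec, ← Matrix.mulVec_transpose, hT, e1, dotProduct_comm]
  simp only [star_trivial, Matrix.mulVec_sub, e1, sub_dotProduct, dotProduct_sub, e2] at h
  rw [dotProduct_comm (A⁻¹ *ᵥ r) r] at h
  linarith

lemma frac_eq {n : ℕ} {A : Matrix (Fin n) (Fin n) ℝ} (hA : A.PosDef) (r : Fin n → ℝ) :
    2 * ((A⁻¹ *ᵥ r) ⬝ᵥ r) - (A⁻¹ *ᵥ r) ⬝ᵥ A *ᵥ (A⁻¹ *ᵥ r) = r ⬝ᵥ A⁻¹ *ᵥ r := by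
  have hu : IsUnit A.det := isUnit_iff_ne_zero.2 hA.det_pos.ne'
  have e1 : A *ᵥ (A⁻¹ *ᵥ r) = r := by
    rw [Matrix.mulVec_mulVec, Matrix.mul_nonsing_inv _ hu, Matrix.one_mulVec]
  rw [e1, dotProduct_comm]; ring

lemma frac_mid {n : ℕ} {A B M : Matrix (Fin n) (Fin n) ℝ} (hA : A.PosDef) (hB : B.PosDef)
    (hM : M.PosDef) (eM : M = (1 / 2 : ℝ) • (A + B)) (a b c : Fin n → ℝ)
    (ec : c = (1 / 2 : ℝ) • (a + b)) :
    c ⬝ᵥ M⁻¹ *ᵥ c ≤ 1 / 2 * (a ⬝ᵥ A⁻¹ *ᵥ a) + 1 / 2 * (b ⬝ᵥ B⁻¹ *ᵥ b) := by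
  rw [← frac_eq hM c]
  set v := M⁻¹ *ᵥ c
  have h1 := frac_ge hA a v
  have h2 := frac_ge hB b v
  have e1 : v ⬝ᵥ M *ᵥ v = 1 / 2 * (v ⬝ᵥ A *ᵥ v) + 1 / 2 * (v ⬝ᵥ B *ᵥ v) := by
    rw [eM, Matrix.smul_mulVec, Matrix.add_mulVec, dotProduct_smul, dotProduct_add]
    simp only [smul_eq_mul]; ring
  have e2 : v ⬝ᵥ c = 1 / 2 * (v ⬝ᵥ a) + 1 / 2 * (v ⬝ᵥ b) := by
    rw [ec, dotProduct_smul, dotProduct_add]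
    simp only [smul_eq_mul]; ring
  rw [e1, e2]; linarith

lemma inv_quad_le {n : ℕ} {A : Matrix (Fin n) (Fin n) ℝ} (hA : A.PosDef) {a : ℝ} (ha : 0 < a)
    (h : ∀ x : Fin n → ℝ, a * (x ⬝ᵥ x) ≤ x ⬝ᵥ A *ᵥ x) (v : Fin n → ℝ) :
    v ⬝ᵥ A⁻¹ *ᵥ v ≤ a⁻¹ * (v ⬝ᵥ v) := by
  have e := frac_eq hA v
  set u := A⁻¹ *ᵥ v
  have h1 := h u
  have h2 : 0 ≤ (v - a • u) ⬝ᵥ (v - a • u) := by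
    simpa using dotProduct_star_self_nonneg (v - a • u)
  simp only [sub_dotProduct, dotProduct_sub, smul_dotProduct, dotProduct_smul, smul_eq_mul] at h2
  rw [dotProduct_comm u v] at *
  rw [inv_mul_eq_div, le_div_iff₀ ha]
  nlinarith

lemma eNorm_sq {ι : Type*} [Fintype ι] (x : ι → ℝ) : eNorm x ^ 2 = x ⬝ᵥ x := by
  unfold eNorm
  rw [Real.sq_sqrt (Finset.sum_nonneg fun _ _ => sq_nonneg _)]
  simp [dotProduct, sq]

lemma eNorm_nonneg {ι : Type*} [Fintype ι] (x : ι → ℝ) : 0 ≤ eNorm x := Real.sqrt_nonneg _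

lemma eNorm_smul {ι : Type*} [Fintype ι] (c : ℝ) (x : ι → ℝ) : eNorm (c • x) = |c| * eNorm x := by
  unfold eNorm
  simp only [Pi.smul_apply, smul_eq_mul, mul_pow, ← Finset.mul_sum]
  rw [Real.sqrt_mul (sq_nonneg _), Real.sqrt_sq_eq_abs]

lemma eNorm_pos {ι : Type*} [Fintype ι] {x : ι → ℝ} (hx : x ≠ 0) : 0 < eNorm x := by
  rcases (eNorm_nonneg x).eq_or_lt with h | h
  · exfalso
    have := eNorm_sq x
    rw [← h] at this
    exact hx (dotProduct_self_eq_zero.1 (by linarith))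
  · exact h

lemma minEig_le {n : ℕ} {A : Matrix (Fin n) (Fin n) ℝ} (hA : A.PosDef) (x : Fin n → ℝ) :
    minEig A * (x ⬝ᵥ x) ≤ x ⬝ᵥ A *ᵥ x := by
  by_cases hx : x = 0
  · simp [hx]
  have hp := eNorm_pos hx
  have hb : BddBelow {r : ℝ | ∃ x : Fin n → ℝ, eNorm x = 1 ∧ r = x ⬝ᵥ A.mulVec x} := by
    refine ⟨0, ?_⟩
    rintro r ⟨y, -, rfl⟩
    simpa using hA.posSemidef.dotProduct_mulVec_nonneg y
  have h : minEig A ≤ ((eNorm x)⁻¹ • x) ⬝ᵥ A *ᵥ ((eNorm x)⁻¹ • x) := by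
    refine csInf_le hb ⟨_, ?_, rfl⟩
    rw [eNorm_smul, abs_of_pos (inv_pos.2 hp), inv_mul_cancel₀ hp.ne']
  rw [Matrix.mulVec_smul, smul_dotProduct, dotProduct_smul, smul_eq_mul, smul_eq_mul, ← mul_assoc,
    ← mul_inv, inv_mul_eq_div, le_div_iff₀ (by positivity)] at h
  rw [← eNorm_sq, sq]; exact h

lemma minEig_pos {n : ℕ} (hn : 0 < n) {A : Matrix (Fin n) (Fin n) ℝ} (hA : A.PosDef) :
    0 < minEig A := by
  have hcont : Continuous (fun x : Fin n → ℝ => eNorm x) := by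
    unfold eNorm; fun_prop
  have hK : IsCompact {x : Fin n → ℝ | eNorm x = 1} := by
    refine Metric.isCompact_of_isClosed_isBounded (isClosed_eq hcont continuous_const) ?_
    refine (Metric.isBounded_closedBall (x := (0 : Fin n → ℝ)) (r := 1)).subset ?_
    intro x hx
    rw [mem_closedBall_zero_iff, pi_norm_le_iff_of_nonneg zero_le_one]
    intro i
    have h1 : x i ^ 2 ≤ 1 := by
      have := eNorm_sq x
      rw [show eNorm x = 1 from hx] at this
      have h2 : x i * x i ≤ x ⬝ᵥ x :=
        Finset.single_le_sum (f := fun i => x i * x i) (fun j _ => mul_self_nonneg _)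
          (Finset.mem_univ i)
      nlinarith
    rw [Real.norm_eq_abs]
    exact (sq_le_one_iff_abs_le_one _).1 h1
  have hne : {x : Fin n → ℝ | eNorm x = 1}.Nonempty := by
    refine ⟨Pi.single ⟨0, hn⟩ 1, ?_⟩
    have := eNorm_sq (Pi.single (⟨0, hn⟩ : Fin n) (1 : ℝ))
    simp at this
    rcases this with h | h
    · exact h
    · have := eNorm_nonneg (Pi.single (⟨0, hn⟩ : Fin n) (1 : ℝ)); linarith
  obtain ⟨x0, hx0, hmin⟩ := hK.exists_isMinOn hne
    (f := fun x => x ⬝ᵥ A *ᵥ x) (by fun_prop)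
  have hx00 : x0 ≠ 0 := by
    rintro rfl
    simp [eNorm] at hx0
  have hpos : 0 < x0 ⬝ᵥ A *ᵥ x0 := by simpa using hA.dotProduct_mulVec_pos hx00
  refine hpos.trans_le (le_csInf ⟨_, x0, hx0, rfl⟩ ?_)
  rintro r ⟨y, hy, rfl⟩
  exact hmin hy

lemma opNorm_nonneg' {n q : ℕ} (Z : Matrix (Fin n) (Fin q) ℝ) : 0 ≤ opNorm Z :=
  Real.sInf_nonneg fun _ h => h.1

lemma opNorm_bound {n q : ℕ} (Z : Matrix (Fin n) (Fin q) ℝ) (x : Fin q → ℝ) :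
    (Z *ᵥ x) ⬝ᵥ (Z *ᵥ x) ≤ opNorm Z ^ 2 * (x ⬝ᵥ x) := by
  by_cases hx : x = 0
  · simp [hx]
  have hp := eNorm_pos hx
  have hne : {c : ℝ | 0 ≤ c ∧ ∀ x : Fin q → ℝ, eNorm (Z.mulVec x) ≤ c * eNorm x}.Nonempty := by
    refine ⟨Real.sqrt (∑ i, ∑ j, Z i j ^ 2), Real.sqrt_nonneg _, fun x => ?_⟩
    unfold eNorm
    have hnn : 0 ≤ ∑ i, ∑ j, Z i j ^ 2 :=
      Finset.sum_nonneg fun _ _ => Finset.sum_nonneg fun _ _ => sq_nonneg _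
    have hsq := Real.sqrt_mul hnn (∑ j, x j ^ 2)
    refine le_of_le_of_eq ?_ hsq
    refine Real.sqrt_le_sqrt ?_
    rw [Finset.sum_mul]
    refine Finset.sum_le_sum fun i _ => ?_
    simpa [Matrix.mulVec, dotProduct] using
      Finset.sum_mul_sq_le_sq_mul_sq Finset.univ (fun j => Z i j) x
  have h : eNorm (Z *ᵥ x) / eNorm x ≤ opNorm Z := by
    refine le_csInf hne ?_
    rintro c ⟨-, hc⟩
    rw [div_le_iff₀ hp]; exact hc x
  rw [div_le_iff₀ hp] at h
  rw [← eNorm_sq, ← eNorm_sq, ← mul_pow]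
  exact pow_le_pow_left₀ (eNorm_nonneg _) h 2

namespace LMEData
variable {m p q : ℕ}

lemma omega_psd (D : LMEData m p q) (i : Fin m) {γ : Vec q} (hγ : ∀ j, 0 ≤ γ j) :
    (D.Z i * diagonal γ * (D.Z i)ᵀ).PosSemidef := by
  have h : (diagonal γ).PosSemidef := Matrix.PosSemidef.diagonal (fun j => hγ j)
  simpa using h.mul_mul_conjTranspose_same (D.Z i)

lemma omega_pos (D : LMEData m p q) (i : Fin m) (hlam : (D.lam i).PosDef)
    {γ : Vec q} (hγ : ∀ j, 0 ≤ γ j) : (D.Omega (diagonal γ) i).PosDef :=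
  Matrix.PosDef.posSemidef_add (D.omega_psd i hγ) hlam

lemma omega_ge (D : LMEData m p q) (i : Fin m) (hlam : (D.lam i).PosDef)
    {γ : Vec q} (hγ : ∀ j, 0 ≤ γ j) (x : Fin (D.n i) → ℝ) :
    minEig (D.lam i) * (x ⬝ᵥ x) ≤ x ⬝ᵥ (D.Omega (diagonal γ) i) *ᵥ x := by
  have h1 := minEig_le hlam x
  have h2 : 0 ≤ x ⬝ᵥ (D.Z i * diagonal γ * (D.Z i)ᵀ) *ᵥ x := by
    simpa using (D.omega_psd i hγ).dotProduct_mulVec_nonneg x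
  unfold Omega
  rw [Matrix.add_mulVec, dotProduct_add]
  linarith

/-- `Zᵀ Ω⁻¹ Z ≤ s I`. -/
lemma P_bound (D : LMEData m p q) (i : Fin m) (hn : 0 < D.n i) (hlam : (D.lam i).PosDef)
    {γ : Vec q} (hγ : ∀ j, 0 ≤ γ j) :
    (((minEig (D.lam i))⁻¹ * opNorm (D.Z i) ^ 2) • (1 : Matrix (Fin q) (Fin q) ℝ)
      - (D.Z i)ᵀ * (D.Omega (diagonal γ) i)⁻¹ * D.Z i).PosSemidef := by
  have hΩ := D.omega_pos i hlam hγ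
  have hP : ((D.Z i)ᵀ * (D.Omega (diagonal γ) i)⁻¹ * D.Z i).PosSemidef := by
    simpa using hΩ.inv.posSemidef.conjTranspose_mul_mul_same (D.Z i)
  refine Matrix.PosSemidef.of_dotProduct_mulVec_nonneg ?_ ?_
  · refine Matrix.IsHermitian.sub ?_ hP.1
    simp [Matrix.IsHermitian]
  · intro x
    have ha := minEig_pos hn hlam
    have h1 := inv_quad_le hΩ ha (D.omega_ge i hlam hγ) (D.Z i *ᵥ x)
    have h2 := opNorm_bound (D.Z i) x
    have h3 := mul_le_mul_of_nonneg_left h2 (inv_pos.2 ha).le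
    have e : x ⬝ᵥ ((D.Z i)ᵀ * (D.Omega (diagonal γ) i)⁻¹ * D.Z i) *ᵥ x
        = (D.Z i *ᵥ x) ⬝ᵥ (D.Omega (diagonal γ) i)⁻¹ *ᵥ (D.Z i *ᵥ x) := by
      rw [← Matrix.mulVec_mulVec, ← Matrix.mulVec_mulVec, Matrix.dotProduct_mulVec,
        Matrix.vecMul_transpose]
    rw [star_trivial, Matrix.sub_mulVec, dotProduct_sub, Matrix.smul_mulVec, Matrix.one_mulVec,
      dotProduct_smul, smul_eq_mul, e]
    linarith

lemma logdet_omega_mid (D : LMEData m p q) (i : Fin m) (hn : 0 < D.n i) (hlam : (D.lam i).PosDef)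
    {γ γ' g : Vec q} (hγ : ∀ j, 0 ≤ γ j) (hγ' : ∀ j, 0 ≤ γ' j) (hg : g = (1 / 2 : ℝ) • (γ + γ')) :
    2 * Real.log (D.Omega (diagonal g) i).det - Real.log (D.Omega (diagonal γ) i).det
      - Real.log (D.Omega (diagonal γ') i).det ≤
      ((minEig (D.lam i))⁻¹ * opNorm (D.Z i) ^ 2) ^ 2 / 4 * ∑ j, (γ j - γ' j) ^ 2 := by
  have hg0 : ∀ j, 0 ≤ g j := by
    intro j; rw [hg]; simp only [Pi.smul_apply, Pi.add_apply, smul_eq_mul]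
    linarith [hγ j, hγ' j]
  set d : Vec q := (1 / 2 : ℝ) • (γ - γ') with hd
  set E := D.Z i * diagonal d * (D.Z i)ᵀ with hE
  have hA := D.omega_pos i hlam hγ
  have hB := D.omega_pos i hlam hγ'
  have hM := D.omega_pos i hlam hg0
  have e1 : γ = g + d := by
    rw [hg, hd]; ext j; simp; ring
  have e2 : γ' = g - d := by
    rw [hg, hd]; ext j; simp; ring
  have dA : diagonal γ = diagonal g + diagonal d := by
    rw [Matrix.diagonal_add]; congr 1
  have dB : diagonal γ' = diagonal g - diagonal d := by
    rw [Matrix.diagonal_sub]; congr 1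
  have eA : D.Omega (diagonal γ) i = D.Omega (diagonal g) i + E := by
    unfold Omega
    rw [dA, Matrix.mul_add, Matrix.add_mul]; abel
  have eB : D.Omega (diagonal γ') i = D.Omega (diagonal g) i - E := by
    unfold Omega
    rw [dB, Matrix.mul_sub, Matrix.sub_mul]; abel
  have hEh : E.IsHermitian := by
    have : (diagonal d)ᴴ = diagonal d := by simp
    have h2 : (diagonal d).IsHermitian := this
    simpa using Matrix.isHermitian_mul_mul_conjTranspose (D.Z i) h2
  have h := logdet_mid hA hB hM hEh eA eB
  have ha := minEig_pos hn hlam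
  have hQ : ((D.Z i)ᵀ * (D.Omega (diagonal γ) i)⁻¹ * D.Z i).PosSemidef := by
    simpa using hA.inv.posSemidef.conjTranspose_mul_mul_same (D.Z i)
  have ht := trace_bound (s := (minEig (D.lam i))⁻¹ * opNorm (D.Z i) ^ 2)
    (mul_nonneg (inv_pos.2 ha).le (sq_nonneg _)) hQ
    (D.P_bound i hn hlam hγ') (D.P_bound i hn hlam hγ) d
  have et : ((D.Omega (diagonal γ') i)⁻¹ * (E * (D.Omega (diagonal γ) i)⁻¹ * E)).trace =
      ((D.Z i)ᵀ * (D.Omega (diagonal γ') i)⁻¹ * D.Z i *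
        (diagonal d * ((D.Z i)ᵀ * (D.Omega (diagonal γ) i)⁻¹ * D.Z i) * diagonal d)).trace := by
    rw [hE]
    simp only [Matrix.mul_assoc]
    rw [Matrix.trace_mul_comm (D.Z i)ᵀ]
    simp only [Matrix.mul_assoc]
  have es : ∑ j, d j ^ 2 = 1 / 4 * ∑ j, (γ j - γ' j) ^ 2 := by
    rw [Finset.mul_sum]
    refine Finset.sum_congr rfl fun j _ => ?_
    rw [hd]; simp only [Pi.smul_apply, Pi.sub_apply, smul_eq_mul]; ring
  rw [et] at h
  rw [es] at ht
  linarith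

lemma nu_ge (D : LMEData m p q) (i : Fin m) :
    (1 : ℝ) / 2 * ((minEig (D.lam i)) ^ 2)⁻¹ * (opNorm (D.Z i)) ^ 4 ≤ D.nu :=
  le_ciSup (f := fun i : Fin m => (1 : ℝ) / 2 * ((minEig (D.lam i)) ^ 2)⁻¹ * (opNorm (D.Z i)) ^ 4)
    (Set.finite_range _).bddAbove i

lemma etabar_nonneg (D : LMEData m p q) : 0 ≤ D.etabar := by
  unfold etabar
  refine mul_nonneg (Real.iSup_nonneg fun i => ?_) (Nat.cast_nonneg _)
  have := opNorm_nonneg' (D.Z i)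
  positivity

lemma L_mid (D : LMEData m p q) (hn : ∀ i, 0 < D.n i) (hlam : ∀ i, (D.lam i).PosDef)
    (b b' : Vec p) {γ γ' : Vec q} (hγ : ∀ j, 0 ≤ γ j) (hγ' : ∀ j, 0 ≤ γ' j) :
    D.L ((1 / 2 : ℝ) • (b + b')) ((1 / 2 : ℝ) • (γ + γ')) ≤
      1 / 2 * D.L b γ + 1 / 2 * D.L b' γ' + D.etabar / 8 * ∑ j, (γ j - γ' j) ^ 2 := by
  have hg0 : ∀ j, 0 ≤ ((1 / 2 : ℝ) • (γ + γ')) j := by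
    intro j; simp only [Pi.smul_apply, Pi.add_apply, smul_eq_mul]
    linarith [hγ j, hγ' j]
  set S := ∑ j, (γ j - γ' j) ^ 2 with hS
  have hS0 : 0 ≤ S := Finset.sum_nonneg fun _ _ => sq_nonneg _
  have e : D.etabar / 8 * S = ∑ _i : Fin m, D.nu / 8 * S := by
    simp [etabar]; ring
  unfold L LML
  rw [e, Finset.mul_sum, Finset.mul_sum, ← Finset.sum_add_distrib, ← Finset.sum_add_distrib]
  refine Finset.sum_le_sum fun i _ => ?_
  have hA := D.omega_pos i (hlam i) hγ
  have hB := D.omega_pos i (hlam i) hγ'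
  have hM := D.omega_pos i (hlam i) hg0
  have eM : D.Omega (diagonal ((1 / 2 : ℝ) • (γ + γ'))) i
      = (1 / 2 : ℝ) • (D.Omega (diagonal γ) i + D.Omega (diagonal γ') i) := by
    have : diagonal ((1 / 2 : ℝ) • (γ + γ')) = (1 / 2 : ℝ) • (diagonal γ + diagonal γ') := by
      rw [Matrix.diagonal_add, ← Matrix.diagonal_smul]; rfl
    unfold Omega
    rw [this, Matrix.mul_smul, Matrix.smul_mul, Matrix.mul_add, Matrix.add_mul]
    ext a c
    simp; ring
  have er : D.y i - D.X i *ᵥ ((1 / 2 : ℝ) • (b + b'))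
      = (1 / 2 : ℝ) • ((D.y i - D.X i *ᵥ b) + (D.y i - D.X i *ᵥ b')) := by
    rw [Matrix.mulVec_smul, Matrix.mulVec_add]
    ext a; simp; ring
  have h1 := frac_mid hA hB hM eM _ _ _ er
  have h2 := D.logdet_omega_mid i (hn i) (hlam i) hγ hγ' rfl
  have h3 := mul_le_mul_of_nonneg_right (D.nu_ge i) hS0
  have h4 : ((minEig (D.lam i))⁻¹ * opNorm (D.Z i) ^ 2) ^ 2
      = ((minEig (D.lam i)) ^ 2)⁻¹ * (opNorm (D.Z i)) ^ 4 := by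
    rw [mul_pow, inv_pow]; ring
  rw [h4] at h2
  linarith

lemma L_lower (D : LMEData m p q) (hlam : ∀ i, (D.lam i).PosDef)
    (b : Vec p) {γ : Vec q} (hγ : ∀ j, 0 ≤ γ j) :
    ∑ i, (1 : ℝ) / 2 * Real.log (D.lam i).det ≤ D.L b γ := by
  unfold L LML
  refine Finset.sum_le_sum fun i _ => ?_
  have hA := D.omega_pos i (hlam i) hγ
  have h1 : 0 ≤ (D.y i - D.X i *ᵥ b) ⬝ᵥ
      ((D.Omega (diagonal γ) i)⁻¹ *ᵥ (D.y i - D.X i *ᵥ b)) := by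
    simpa using hA.inv.posSemidef.dotProduct_mulVec_nonneg (D.y i - D.X i *ᵥ b)
  have h2 := logdet_mono (hlam i) (D.omega_psd i hγ)
  rw [add_comm (D.lam i)] at h2
  change _ ≤ Real.log (D.Omega (diagonal γ) i).det at h2
  linarith

lemma L_cont (D : LMEData m p q) (hlam : ∀ i, (D.lam i).PosDef)
    (x : Vec p × Vec q) (hγ : ∀ j, 0 ≤ x.2 j) :
    ContinuousAt (fun x : Vec p × Vec q => D.L x.1 x.2) x := by
  unfold L LML
  refine tendsto_finsetSum _ fun i _ => ?_
  have hA := D.omega_pos i (hlam i) hγ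
  have hO : Continuous (fun x : Vec p × Vec q => D.Omega (diagonal x.2) i) := by
    unfold Omega; fun_prop
  have hI : ContinuousAt (fun x : Vec p × Vec q => (D.Omega (diagonal x.2) i)⁻¹) x := by
    refine ContinuousAt.comp (g := Inv.inv) ?_ hO.continuousAt
    refine continuousAt_matrix_inv _ ?_
    have : (Ring.inverse : ℝ → ℝ) = Inv.inv := by ext; simp
    rw [this]
    exact continuousAt_inv₀ hA.det_pos.ne'
  have hr : Continuous (fun x : Vec p × Vec q => D.y i - D.X i *ᵥ x.1) := by fun_prop
  have hv : ContinuousAt (fun x : Vec p × Vec q =>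
      (D.Omega (diagonal x.2) i)⁻¹ *ᵥ (D.y i - D.X i *ᵥ x.1)) x := by
    have hc : Continuous (fun y : Matrix (Fin (D.n i)) (Fin (D.n i)) ℝ × (Fin (D.n i) → ℝ) =>
      y.1 *ᵥ y.2) := by fun_prop
    exact hc.continuousAt.comp (f := fun x : Vec p × Vec q =>
      ((D.Omega (diagonal x.2) i)⁻¹, D.y i - D.X i *ᵥ x.1)) (hI.prodMk hr.continuousAt)
  have hq : ContinuousAt (fun x : Vec p × Vec q => (D.y i - D.X i *ᵥ x.1) ⬝ᵥ
      (D.Omega (diagonal x.2) i)⁻¹ *ᵥ (D.y i - D.X i *ᵥ x.1)) x := by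
    have hc : Continuous (fun y : (Fin (D.n i) → ℝ) × (Fin (D.n i) → ℝ) =>
      y.1 ⬝ᵥ y.2) := by fun_prop
    exact hc.continuousAt.comp (f := fun x : Vec p × Vec q => (D.y i - D.X i *ᵥ x.1,
      (D.Omega (diagonal x.2) i)⁻¹ *ᵥ (D.y i - D.X i *ᵥ x.1))) (hr.continuousAt.prodMk hv)
  have hl : ContinuousAt (fun x : Vec p × Vec q => Real.log (D.Omega (diagonal x.2) i).det) x :=
    ContinuousAt.log hO.matrix_det.continuousAt hA.det_pos.ne'
  exact (continuousAt_const.mul hq).add (continuousAt_const.mul hl)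

end LMEData

section AbstractPart
variable {p q : ℕ}

lemma sqnorm2_nonneg (w : Vec p × Vec q) : 0 ≤ sqnorm2 w :=
  add_nonneg (Finset.sum_nonneg fun _ _ => sq_nonneg _) (Finset.sum_nonneg fun _ _ => sq_nonneg _)

lemma sqnorm2_cont : Continuous (fun w : Vec p × Vec q => sqnorm2 w) := by
  unfold sqnorm2; fun_prop

lemma norm_le_sqrt_sqnorm2 (w : Vec p × Vec q) : ‖w‖ ≤ Real.sqrt (sqnorm2 w) := by
  have h1 : 0 ≤ ∑ j, w.1 j ^ 2 := Finset.sum_nonneg fun _ _ => sq_nonneg _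
  have h2 : 0 ≤ ∑ j, w.2 j ^ 2 := Finset.sum_nonneg fun _ _ => sq_nonneg _
  rw [Prod.norm_def, max_le_iff]
  constructor
  · rw [pi_norm_le_iff_of_nonneg (Real.sqrt_nonneg _)]
    intro i
    rw [Real.norm_eq_abs]
    refine Real.abs_le_sqrt ?_
    have := Finset.single_le_sum (f := fun j => w.1 j ^ 2) (fun j _ => sq_nonneg _)
      (Finset.mem_univ i)
    unfold sqnorm2; linarith
  · rw [pi_norm_le_iff_of_nonneg (Real.sqrt_nonneg _)]
    intro i
    rw [Real.norm_eq_abs]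
    refine Real.abs_le_sqrt ?_
    have := Finset.single_le_sum (f := fun j => w.2 j ^ 2) (fun j _ => sq_nonneg _)
      (Finset.mem_univ i)
    unfold sqnorm2; linarith

lemma eq_of_sqnorm2_le {x y : Vec p × Vec q} (h : sqnorm2 (x - y) ≤ 0) : x = y := by
  have h1 := norm_le_sqrt_sqnorm2 (x - y)
  rw [Real.sqrt_eq_zero'.2 h] at h1
  exact sub_eq_zero.1 (norm_le_zero_iff.1 h1)

/-- a pointwise identity lifted to `sqnorm2` -/
lemma kappa_mid (η : ℝ) (x y w : Vec p × Vec q) :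
    kappaFun η ((1 / 2 : ℝ) • (x + y) - w) =
      1 / 2 * kappaFun η (x - w) + 1 / 2 * kappaFun η (y - w) - η / 8 * sqnorm2 (x - y) := by
  have key : ∀ {k : ℕ} (a b c : Vec k), ∑ j, (((1 / 2 : ℝ) • (a + b) - c) j) ^ 2
      = 1 / 2 * ∑ j, ((a - c) j) ^ 2 + 1 / 2 * ∑ j, ((b - c) j) ^ 2
        - 1 / 4 * ∑ j, ((a - b) j) ^ 2 := by
    intro k a b c
    simp only [Finset.mul_sum, ← Finset.sum_add_distrib, ← Finset.sum_sub_distrib]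
    refine Finset.sum_congr rfl fun j _ => ?_
    simp only [Pi.sub_apply, Pi.smul_apply, Pi.add_apply, smul_eq_mul]
    ring
  have h1 := key x.1 y.1 w.1
  have h2 := key x.2 y.2 w.2
  unfold kappaFun sqnorm2
  simp only [Prod.fst_sub, Prod.snd_sub, Prod.smul_fst, Prod.smul_snd, Prod.fst_add,
    Prod.snd_add] at *
  rw [h1, h2]; ring

/-- cross terms and the Young inequality -/
lemma kappa_cross {η δ : ℝ} (hδ : 0 < δ) (x y w v : Vec p × Vec q) :
    kappaFun η (y - w) - kappaFun η (x - w) + kappaFun η (x - v) - kappaFun η (y - v)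
      ≤ δ / 4 * sqnorm2 (y - x) + η ^ 2 / δ * sqnorm2 (v - w) := by
  have key : ∀ {k : ℕ} (a b c d : Vec k),
      η / 2 * ∑ j, ((b - c) j) ^ 2 - η / 2 * ∑ j, ((a - c) j) ^ 2 + η / 2 * ∑ j, ((a - d) j) ^ 2
        - η / 2 * ∑ j, ((b - d) j) ^ 2
      ≤ δ / 4 * ∑ j, ((b - a) j) ^ 2 + η ^ 2 / δ * ∑ j, ((d - c) j) ^ 2 := by
    intro k a b c d
    simp only [Finset.mul_sum, ← Finset.sum_add_distrib, ← Finset.sum_sub_distrib]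
    refine Finset.sum_le_sum fun j _ => ?_
    simp only [Pi.sub_apply]
    have h : 0 ≤ δ / 4 * ((b j - a j) - 2 * η / δ * (d j - c j)) ^ 2 := by positivity
    have e : δ / 4 * ((b j - a j) - 2 * η / δ * (d j - c j)) ^ 2
        = δ / 4 * (b j - a j) ^ 2 - η * (b j - a j) * (d j - c j)
          + η ^ 2 / δ * (d j - c j) ^ 2 := by
      field_simp; ring
    rw [e] at h
    nlinarith
  have h1 := key x.1 y.1 w.1 v.1
  have h2 := key x.2 y.2 w.2 v.2
  unfold kappaFun sqnorm2
  simp only [Prod.fst_sub, Prod.snd_sub]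
  linarith

theorem abstract_prox (C : Set (Vec p × Vec q)) (G : Vec p × Vec q → ℝ) (η δ : ℝ)
    (hη : 0 < η) (hδ : 0 < δ) (F : Vec p × Vec q → Vec p × Vec q → EReal)
    (hF1 : ∀ x ∈ C, ∀ w, F x w = ((G x + kappaFun η (x - w) : ℝ) : EReal))
    (hF2 : ∀ x, x ∉ C → ∀ w, F x w = ⊤)
    (hmid : ∀ x ∈ C, ∀ y ∈ C, (1 / 2 : ℝ) • (x + y) ∈ C ∧
      G ((1 / 2 : ℝ) • (x + y)) ≤ 1 / 2 * G x + 1 / 2 * G y + (η - δ) / 8 * sqnorm2 (x - y))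
    (hne : C.Nonempty)
    (hlow : ∀ w, ∃ c, ∀ x ∈ C, c ≤ G x + kappaFun η (x - w))
    (hcl : ∀ (s : ℕ → Vec p × Vec q) (x : Vec p × Vec q) (M : ℝ), (∀ k, s k ∈ C) →
      Tendsto s atTop (𝓝 x) → (∀ k, G (s k) ≤ M) →
      x ∈ C ∧ Tendsto (fun k => G (s k)) atTop (𝓝 (G x))) :
    (∀ w : Vec p × Vec q, ∃! x : Vec p × Vec q, ∀ x' : Vec p × Vec q, F x w ≤ F x' w) ∧
    (∀ w : Vec p × Vec q, (⨅ x, F x w) ≠ ⊤ ∧ (⨅ x, F x w) ≠ ⊥) ∧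
    Continuous (fun w : Vec p × Vec q => (⨅ x, F x w).toReal) ∧
    ∀ S : Vec p × Vec q → Vec p × Vec q,
      (∀ w x' : Vec p × Vec q, F (S w) w ≤ F x' w) →
      (∀ w, S w ∈ C) ∧ Continuous S := by
  have hkc : Continuous (fun w : Vec p × Vec q => kappaFun η w) := by
    unfold kappaFun; exact continuous_const.mul sqnorm2_cont
  have hk0 : ∀ w : Vec p × Vec q, 0 ≤ kappaFun η w := fun w =>
    mul_nonneg (by positivity) (sqnorm2_nonneg w)
  -- strong midpoint convexity
  have hstrong : ∀ w, ∀ x ∈ C, ∀ y ∈ C,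
      G ((1 / 2 : ℝ) • (x + y)) + kappaFun η ((1 / 2 : ℝ) • (x + y) - w) ≤
      1 / 2 * (G x + kappaFun η (x - w)) + 1 / 2 * (G y + kappaFun η (y - w))
        - δ / 8 * sqnorm2 (x - y) := by
    intro w x hx y hy
    have h1 := (hmid x hx y hy).2
    rw [kappa_mid]
    linarith
  -- characterization of minimizers
  have hchar : ∀ w x, (∀ x', F x w ≤ F x' w) →
      x ∈ C ∧ ∀ y ∈ C, G x + kappaFun η (x - w) ≤ G y + kappaFun η (y - w) := by
    intro w x h
    have hx : x ∈ C := by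
      by_contra hx
      obtain ⟨y, hy⟩ := hne
      have := h y
      rw [hF2 x hx, hF1 y hy, top_le_iff] at this
      exact EReal.coe_ne_top _ this
    refine ⟨hx, fun y hy => ?_⟩
    have := h y
    rw [hF1 x hx, hF1 y hy] at this
    exact EReal.coe_le_coe_iff.1 this
  have hchar' : ∀ w, ∀ x ∈ C, (∀ y ∈ C, G x + kappaFun η (x - w) ≤ G y + kappaFun η (y - w)) →
      ∀ x', F x w ≤ F x' w := by
    intro w x hx h x'
    by_cases hx' : x' ∈ C
    · rw [hF1 x hx, hF1 x' hx']
      exact EReal.coe_le_coe_iff.2 (h x' hx')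
    · rw [hF2 x' hx']; exact le_top
  -- quadratic growth
  have hgrow : ∀ w, ∀ x ∈ C, (∀ y ∈ C, G x + kappaFun η (x - w) ≤ G y + kappaFun η (y - w)) →
      ∀ y ∈ C, δ / 4 * sqnorm2 (y - x) ≤
        (G y + kappaFun η (y - w)) - (G x + kappaFun η (x - w)) := by
    intro w x hx h y hy
    have h1 := hstrong w y hy x hx
    have h2 := h _ (hmid y hy x hx).1
    linarith
  -- existence
  have hex : ∀ w, ∃ x ∈ C, ∀ y ∈ C, G x + kappaFun η (x - w) ≤ G y + kappaFun η (y - w) := by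
    intro w
    set H : Vec p × Vec q → ℝ := fun x => G x + kappaFun η (x - w) with hH
    obtain ⟨c, hc⟩ := hlow w
    have hbdd : BddBelow (H '' C) := ⟨c, by rintro _ ⟨x, hx, rfl⟩; exact hc x hx⟩
    set μ0 := sInf (H '' C) with hμ0
    have hle : ∀ x ∈ C, μ0 ≤ H x := fun x hx => csInf_le hbdd ⟨x, hx, rfl⟩
    have hseq : ∀ k : ℕ, ∃ x ∈ C, H x < μ0 + 1 / ((k : ℝ) + 1) := by
      intro k
      obtain ⟨_, ⟨x, hx, rfl⟩, h⟩ := exists_lt_of_csInf_lt (hne.image H)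
        (show sInf (H '' C) < μ0 + 1 / ((k : ℝ) + 1) by
          have : 0 < 1 / ((k : ℝ) + 1) := by positivity
          linarith)
      exact ⟨x, hx, h⟩
    choose s hs hs' using hseq
    have hone : ∀ {N k : ℕ}, N ≤ k → H (s k) ≤ μ0 + 1 / ((N : ℝ) + 1) := by
      intro N k h
      exact (hs' k).le.trans (by gcongr)
    have hcau : CauchySeq s := by
      refine cauchySeq_of_le_tendsto_0 (fun N : ℕ => Real.sqrt (8 / δ * (1 / ((N : ℝ) + 1)))) ?_ ?_
      · intro k l N hk hl
        rw [dist_eq_norm]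
        refine (norm_le_sqrt_sqnorm2 _).trans (Real.sqrt_le_sqrt ?_)
        have h1 : μ0 ≤ _ := hle _ (hmid _ (hs k) _ (hs l)).1
        have h2 := hstrong w _ (hs k) _ (hs l)
        have h3 := hone hk
        have h4 := hone hl
        simp only [hH] at h1 h3 h4
        rw [div_mul_eq_mul_div, le_div_iff₀ hδ]
        linarith
      · have h := (tendsto_one_div_add_atTop_nhds_zero_nat (𝕜 := ℝ)).const_mul (8 / δ)
        have h' := (Real.continuous_sqrt.tendsto _).comp h
        simpa [Function.comp_def] using h'
    obtain ⟨x, hx⟩ := cauchySeq_tendsto_of_complete hcau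
    have hM : ∀ k, G (s k) ≤ μ0 + 1 := by
      intro k
      have h1 := hone (Nat.zero_le k)
      have h2 := hk0 (s k - w)
      simp only [hH, Nat.cast_zero] at h1
      linarith
    obtain ⟨hxC, hG⟩ := hcl s x _ hs hx hM
    refine ⟨x, hxC, fun y hy => le_trans ?_ (hle y hy)⟩
    have hH' : Tendsto (fun k => H (s k)) atTop (𝓝 (G x + kappaFun η (x - w))) :=
      hG.add ((hkc.tendsto _).comp (hx.sub_const w))
    have hr : Tendsto (fun k : ℕ => μ0 + 1 / ((k : ℝ) + 1)) atTop (𝓝 (μ0 + 0)) :=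
      (tendsto_one_div_add_atTop_nhds_zero_nat (𝕜 := ℝ)).const_add μ0
    rw [add_zero] at hr
    exact le_of_tendsto_of_tendsto' hH' hr fun k => (hs' k).le
  -- solution maps
  have hSC : ∀ S : Vec p × Vec q → Vec p × Vec q,
      (∀ w x' : Vec p × Vec q, F (S w) w ≤ F x' w) → (∀ w, S w ∈ C) ∧ Continuous S := by
    intro S hS
    refine ⟨fun w => (hchar w _ (hS w)).1, ?_⟩
    rw [continuous_iff_continuousAt]
    intro w
    have hb : ∀ v, sqnorm2 (S v - S w) ≤ 4 * η ^ 2 / δ ^ 2 * sqnorm2 (v - w) := by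
      intro v
      obtain ⟨a1, a2⟩ := hchar w _ (hS w)
      obtain ⟨b1, b2⟩ := hchar v _ (hS v)
      have h1 := hgrow w _ a1 a2 _ b1
      have h2 := b2 _ a1
      have h2' := hgrow v _ b1 b2 _ a1
      have h3 := kappa_cross (η := η) hδ (S w) (S v) w v
      have h5 : δ / 4 * sqnorm2 (S v - S w) ≤ η ^ 2 / δ * sqnorm2 (v - w) := by
        have hsym : sqnorm2 (S w - S v) = sqnorm2 (S v - S w) := by
          unfold sqnorm2
          congr 1 <;> refine Finset.sum_congr rfl fun j _ => ?_
          · simp only [Prod.fst_sub, Pi.sub_apply]; ring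
          · simp only [Prod.snd_sub, Pi.sub_apply]; ring
        rw [hsym] at h2'
        linarith
      have e : 4 * η ^ 2 / δ ^ 2 * sqnorm2 (v - w)
          = 4 / δ * (η ^ 2 / δ * sqnorm2 (v - w)) := by field_simp
      rw [e]
      have := mul_le_mul_of_nonneg_left h5 (show 0 ≤ 4 / δ by positivity)
      refine le_trans (le_of_eq ?_) this
      field_simp
    rw [ContinuousAt, tendsto_iff_norm_sub_tendsto_zero]
    have hlim : Tendsto (fun v => Real.sqrt (4 * η ^ 2 / δ ^ 2 * sqnorm2 (v - w))) (𝓝 w) (𝓝 0) := by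
      have hc : Continuous (fun v => Real.sqrt (4 * η ^ 2 / δ ^ 2 * sqnorm2 (v - w))) :=
        Real.continuous_sqrt.comp
          (continuous_const.mul (sqnorm2_cont.comp (continuous_id.sub continuous_const)))
      have := hc.tendsto w
      simpa [sqnorm2] using this
    exact squeeze_zero (fun _ => norm_nonneg _)
      (fun v => (norm_le_sqrt_sqnorm2 _).trans (Real.sqrt_le_sqrt (hb v))) hlim
  choose T hT hT' using hex
  have hTmin : ∀ w x', F (T w) w ≤ F x' w := fun w => hchar' w _ (hT w) (hT' w)
  have hval : ∀ w, (⨅ x, F x w) = ((G (T w) + kappaFun η (T w - w) : ℝ) : EReal) := by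
    intro w
    rw [← hF1 _ (hT w) w]
    exact le_antisymm (iInf_le _ _) (le_iInf (hTmin w))
  have hTc := (hSC T hTmin).2
  refine ⟨?_, ?_, ?_, hSC⟩
  · intro w
    refine ⟨T w, hTmin w, fun y hy => ?_⟩
    obtain ⟨y1, y2⟩ := hchar w y hy
    have h1 := hgrow w _ (hT w) (hT' w) y y1
    have h2 := y2 _ (hT w)
    refine eq_of_sqnorm2_le ?_
    by_contra hcon
    push Not at hcon
    have : 0 < δ / 4 * sqnorm2 (y - T w) := by positivity
    linarith
  · intro w
    rw [hval]
    exact ⟨EReal.coe_ne_top _, EReal.coe_ne_bot _⟩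
  · have e : (fun w : Vec p × Vec q => (⨅ x, F x w).toReal)
        = fun w => G (T w) + kappaFun η (T w - w) := by
      ext w; rw [hval, EReal.toReal_coe]
    rw [e, continuous_iff_continuousAt]
    intro w
    have hup : ∀ v, G (T v) + kappaFun η (T v - v) ≤
        (G (T w) + kappaFun η (T w - w)) + (kappaFun η (T w - v) - kappaFun η (T w - w)) := by
      intro v
      have := hT' v _ (hT w)
      linarith
    have hlo : ∀ v, (G (T w) + kappaFun η (T w - w)) +
        (kappaFun η (T v - v) - kappaFun η (T v - w)) ≤ G (T v) + kappaFun η (T v - v) := by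
      intro v
      have := hT' w _ (hT v)
      linarith
    refine tendsto_of_tendsto_of_tendsto_of_le_of_le ?_ ?_ hlo hup
    · have hc : Continuous (fun v => (G (T w) + kappaFun η (T w - w)) +
        (kappaFun η (T v - v) - kappaFun η (T v - w))) :=
        continuous_const.add ((hkc.comp (hTc.sub continuous_id)).sub
          (hkc.comp (hTc.sub continuous_const)))
      have := hc.tendsto w
      simpa using this
    · have hc : Continuous (fun v => (G (T w) + kappaFun η (T w - w)) +
        (kappaFun η (T w - v) - kappaFun η (T w - w))) :=
        continuous_const.add ((hkc.comp (continuous_const.sub continuous_id)).sub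
          continuous_const)
      have := hc.tendsto w
      simpa using this

end AbstractPart

/-- For μ ≥ 0, η > η̄, the inner problem has a unique solution for every
(β̃,γ̃); the value function u_{η,μ} is finite everywhere and continuous, and every
solution mapping is ℝ_+^q-valued in its γ-component and continuous. -/
theorem value_function_and_solution_map_continuous
    {m p q : ℕ} (hm : 0 < m) (hp : 0 < p) (hq : 0 < q)
    (D : LMEData m p q) (hn : ∀ i, 0 < D.n i) (hlam : ∀ i, (D.lam i).PosDef)
    (μ η : ℝ) (hμ : 0 ≤ μ) (hη : D.etabar < η) :
    (∀ w : Vec p × Vec q, ∃! x : Vec p × Vec q,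
      ∀ x' : Vec p × Vec q, D.Lrelax η μ x w ≤ D.Lrelax η μ x' w) ∧
    (∀ w : Vec p × Vec q, D.uval η μ w ≠ ⊤ ∧ D.uval η μ w ≠ ⊥) ∧
    Continuous (fun w : Vec p × Vec q => (D.uval η μ w).toReal) ∧
    ∀ S : Vec p × Vec q → Vec p × Vec q,
      (∀ w x' : Vec p × Vec q, D.Lrelax η μ (S w) w ≤ D.Lrelax η μ x' w) →
      (∀ w j, 0 ≤ (S w).2 j) ∧ Continuous S := by
  have hη0 : 0 < η := lt_of_le_of_lt D.etabar_nonneg hη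
  have hδ : 0 < η - D.etabar := by linarith
  have hbd : ∀ x y : Vec p × Vec q, D.etabar / 8 * ∑ j, (x.2 j - y.2 j) ^ 2
      ≤ (η - (η - D.etabar)) / 8 * sqnorm2 (x - y) := by
    intro x y
    have h0 : 0 ≤ ∑ j, (x.1 j - y.1 j) ^ 2 := Finset.sum_nonneg fun _ _ => sq_nonneg _
    have h1 : ∑ j, (x.2 j - y.2 j) ^ 2 ≤ sqnorm2 (x - y) := by
      unfold sqnorm2
      simp only [Prod.fst_sub, Prod.snd_sub, Pi.sub_apply]
      linarith
    rw [sub_sub_cancel]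
    exact mul_le_mul_of_nonneg_left h1 (by linarith [D.etabar_nonneg])
  rcases hμ.eq_or_lt with rfl | hμ
  · have hmain := abstract_prox {x : Vec p × Vec q | ∀ j, 0 ≤ x.2 j} (fun x => D.L x.1 x.2)
      η (η - D.etabar) hη0 hδ (D.Lrelax η 0) ?_ ?_ ?_ ?_ ?_ ?_
    · exact hmain
    · intro x hx w
      have hx' : ∀ j, 0 ≤ x.2 j := hx
      simp [LMEData.Lrelax, phiBar, hx']
    · intro x hx w
      have hx' : ¬ ∀ j, 0 ≤ x.2 j := hx
      unfold LMEData.Lrelax phiBar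
      rw [if_pos rfl, if_neg hx']
      exact EReal.coe_add_top _
    · intro x hx y hy
      refine ⟨fun j => ?_, ?_⟩
      · have h1 := hx j
        have h2 := hy j
        simp only [Prod.smul_snd, Prod.snd_add, Pi.smul_apply, Pi.add_apply, smul_eq_mul]
        linarith
      · have h1 := D.L_mid hn hlam x.1 y.1 hx hy
        have h2 := hbd x y
        simp only [Prod.smul_snd, Prod.snd_add, Prod.smul_fst, Prod.fst_add]
        linarith
    · exact ⟨0, fun j => le_rfl⟩
    · intro w
      refine ⟨_, fun x hx => (D.L_lower hlam x.1 hx).trans ?_⟩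
      have : 0 ≤ kappaFun η (x - w) := mul_nonneg (by positivity) (sqnorm2_nonneg _)
      linarith
    · intro s x M hs hx _
      have hxC : ∀ j, 0 ≤ x.2 j := fun j =>
        ge_of_tendsto' ((((continuous_apply j).comp continuous_snd).tendsto x).comp hx)
          fun k => hs k j
      exact ⟨hxC, (D.L_cont hlam x hxC).tendsto.comp hx⟩
  · have hmain := abstract_prox {x : Vec p × Vec q | ∀ j, 0 < x.2 j}
      (fun x => D.L x.1 x.2 + (-μ) * ∑ j, Real.log (x.2 j / μ))
      η (η - D.etabar) hη0 hδ (D.Lrelax η μ) ?_ ?_ ?_ ?_ ?_ ?_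
    · obtain ⟨h1, h2, h3, h4⟩ := hmain
      refine ⟨h1, h2, h3, fun S hS => ⟨fun w j => ((h4 S hS).1 w j).le, (h4 S hS).2⟩⟩
    · intro x hx w
      have hx' : ∀ j, 0 < x.2 j := hx
      unfold LMEData.Lrelax phiBar
      rw [if_neg hμ.ne', if_pos hμ, if_pos hx', ← EReal.coe_add]
      congr 1; ring
    · intro x hx w
      have hx' : ¬ ∀ j, 0 < x.2 j := hx
      unfold LMEData.Lrelax phiBar
      rw [if_neg hμ.ne', if_pos hμ, if_neg hx']
      exact EReal.coe_add_top _
    · intro x hx y hy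
      refine ⟨fun j => ?_, ?_⟩
      · have h1 := hx j
        have h2 := hy j
        simp only [Prod.smul_snd, Prod.snd_add, Pi.smul_apply, Pi.add_apply, smul_eq_mul]
        linarith
      · have h1 := D.L_mid hn hlam x.1 y.1 (fun j => (hx j).le) (fun j => (hy j).le)
        have h2 := hbd x y
        have h3 : 1 / 2 * ∑ j, Real.log (x.2 j / μ) + 1 / 2 * ∑ j, Real.log (y.2 j / μ)
            ≤ ∑ j, Real.log (((1 / 2 : ℝ) • (x.2 + y.2)) j / μ) := by
          rw [Finset.mul_sum, Finset.mul_sum, ← Finset.sum_add_distrib]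
          refine Finset.sum_le_sum fun j _ => ?_
          have ha : 0 < x.2 j / μ := div_pos (hx j) hμ
          have hb : 0 < y.2 j / μ := div_pos (hy j) hμ
          have hc := strictConcaveOn_log_Ioi.concaveOn.2 (Set.mem_Ioi.2 ha) (Set.mem_Ioi.2 hb)
            (show (0 : ℝ) ≤ 1 / 2 by norm_num) (show (0 : ℝ) ≤ 1 / 2 by norm_num) (by norm_num)
          simp only [smul_eq_mul] at hc
          refine hc.trans (le_of_eq ?_)
          congr 1
          simp only [Pi.smul_apply, Pi.add_apply, smul_eq_mul]
          ring
        have h4 := mul_le_mul_of_nonneg_left h3 hμ.le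
        simp only [Prod.smul_snd, Prod.snd_add, Prod.smul_fst, Prod.fst_add]
        linarith
    · exact ⟨(0, fun _ => 1), fun j => zero_lt_one⟩
    · intro w
      refine ⟨∑ i, (1 : ℝ) / 2 * Real.log (D.lam i).det + ∑ j, (μ - w.2 j - 1 / (2 * η)),
        fun x hx => ?_⟩
      have h1 := D.L_lower hlam x.1 (fun j => (hx j).le)
      have h2 : ∑ j, (μ - w.2 j - 1 / (2 * η)) ≤
          ∑ j, (-μ * Real.log (x.2 j / μ) + η / 2 * (x.2 j - w.2 j) ^ 2) := by
        refine Finset.sum_le_sum fun j _ => ?_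
        have ha : 0 < x.2 j / μ := div_pos (hx j) hμ
        have hl := mul_le_mul_of_nonneg_left (Real.log_le_sub_one_of_pos ha) hμ.le
        have e1 : μ * (x.2 j / μ - 1) = x.2 j - μ := by field_simp
        have e2 : η / 2 * ((x.2 j - w.2 j) - 1 / η) ^ 2
            = η / 2 * (x.2 j - w.2 j) ^ 2 - (x.2 j - w.2 j) + 1 / (2 * η) := by
          field_simp; ring
        have e3 : 0 ≤ η / 2 * ((x.2 j - w.2 j) - 1 / η) ^ 2 := by positivity
        rw [e1] at hl
        rw [e2] at e3
        linarith
      rw [Finset.sum_add_distrib, ← Finset.mul_sum, ← Finset.mul_sum] at h2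
      have h3 : η / 2 * ∑ j, (x.2 j - w.2 j) ^ 2 ≤ kappaFun η (x - w) := by
        unfold kappaFun sqnorm2
        refine mul_le_mul_of_nonneg_left ?_ (by positivity)
        simp only [Prod.fst_sub, Prod.snd_sub, Pi.sub_apply]
        have h0 : 0 ≤ ∑ j, (x.1 j - w.1 j) ^ 2 := Finset.sum_nonneg fun _ _ => sq_nonneg _
        linarith
      linarith
    · intro s x M hs hx hM
      have hcoord : ∀ j, Tendsto (fun k => (s k).2 j) atTop (𝓝 (x.2 j)) := fun j =>
        (((continuous_apply j).comp continuous_snd).tendsto x).comp hx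
      have hx0 : ∀ j, 0 ≤ x.2 j := fun j => ge_of_tendsto' (hcoord j) fun k => (hs k j).le
      set c := ∑ i, (1 : ℝ) / 2 * Real.log (D.lam i).det with hc
      have hprod : ∀ k, Real.exp ((c - M) / μ) ≤ ∏ j, ((s k).2 j / μ) := by
        intro k
        have h1 := D.L_lower hlam (s k).1 (fun j => (hs k j).le)
        have h2 := hM k
        have hpos : ∀ j, 0 < (s k).2 j / μ := fun j => div_pos (hs k j) hμ
        rw [← Real.le_log_iff_exp_le (Finset.prod_pos fun j _ => hpos j),
          Real.log_prod (fun j _ => (hpos j).ne'), div_le_iff₀ hμ]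
        linarith
      have hlim : Tendsto (fun k => ∏ j, ((s k).2 j / μ)) atTop (𝓝 (∏ j, (x.2 j / μ))) :=
        tendsto_finsetProd _ fun j _ => (hcoord j).div_const μ
      have hge := ge_of_tendsto' hlim hprod
      have hne : ∏ j, (x.2 j / μ) ≠ 0 := ((Real.exp_pos _).trans_le hge).ne'
      have hxC : ∀ j, 0 < x.2 j := by
        intro j
        refine lt_of_le_of_ne (hx0 j) fun h => ?_
        exact hne (Finset.prod_eq_zero (Finset.mem_univ j) (by rw [← h, zero_div]))
      refine ⟨hxC, ((D.L_cont hlam x hx0).tendsto.comp hx).add (Tendsto.const_mul _ ?_)⟩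
      exact tendsto_finsetSum _ fun j _ =>
        ((hcoord j).div_const μ).log (div_pos (hxC j) hμ).ne'
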